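/- For every odd integer n ≥ 3, there is no CNAT of size n all of whose leaves are short; i.e. the set A_n of CNATs of size n with only short leaves is empty when n ≥ 3 is odd. -/

import Mathlib

/-!
Formalization of complete non-ambiguous trees (CNATs).

A CNAT of size `n` is modelled as a Boolean filling `D : Fin n → Fin n → Bool`
of the `n × n` grid (`D i j = true` meaning that cell in row `i`, column `j`
is dotted; rows are numbered from the top, columns from the left, `0`-based),
satisfying the root, non-ambiguity, minimality and completeness conditions.
-/

namespace CNATf

/-- A filling of the `n × n` grid. -/
abbrev Grid (n : ℕ) := Fin n → Fin n → Bool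

/-- Cell `(i, j)` is dotted. -/
def Dotted {n : ℕ} (D : Grid n) (i j : Fin n) : Prop := D i j = true

/-- There is a dotted cell above `(i, j)` in the same column. -/
def HasDotAbove {n : ℕ} (D : Grid n) (i j : Fin n) : Prop :=
  ∃ i' : Fin n, i' < i ∧ Dotted D i' j

/-- There is a dotted cell to the left of `(i, j)` in the same row. -/
def HasDotLeft {n : ℕ} (D : Grid n) (i j : Fin n) : Prop :=
  ∃ j' : Fin n, j' < j ∧ Dotted D i j'

/-- There is a dotted cell below `(i, j)` in the same column. -/
def HasDotBelow {n : ℕ} (D : Grid n) (i j : Fin n) : Prop :=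
  ∃ i' : Fin n, i < i' ∧ Dotted D i' j

/-- There is a dotted cell to the right of `(i, j)` in the same row. -/
def HasDotRight {n : ℕ} (D : Grid n) (i j : Fin n) : Prop :=
  ∃ j' : Fin n, j < j' ∧ Dotted D i j'

/-- `D` is a complete non-ambiguous tree (CNAT) on the `n × n` grid:
root, non-ambiguity, minimality (rows and columns), completeness. -/
def IsCNAT {n : ℕ} (D : Grid n) : Prop :=
  (∀ i j : Fin n, (i : ℕ) = 0 → (j : ℕ) = 0 → Dotted D i j) ∧
  (∀ i j : Fin n, Dotted D i j → ¬((i : ℕ) = 0 ∧ (j : ℕ) = 0) →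
      Xor' (HasDotAbove D i j) (HasDotLeft D i j)) ∧
  (∀ i : Fin n, ∃ j : Fin n, Dotted D i j) ∧
  (∀ j : Fin n, ∃ i : Fin n, Dotted D i j) ∧
  (∀ i j : Fin n, Dotted D i j →
      (HasDotBelow D i j ∧ HasDotRight D i j) ∨ (¬HasDotBelow D i j ∧ ¬HasDotRight D i j))

/-- A leaf: a dotted cell with no dot below it in its column and no dot
to its right in its row. -/
def IsLeaf {n : ℕ} (D : Grid n) (i j : Fin n) : Prop :=
  Dotted D i j ∧ ¬HasDotBelow D i j ∧ ¬HasDotRight D i j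

/-- An internal dot: a dotted cell with both a dot below it in its column and
a dot to its right in its row. -/
def IsInternal {n : ℕ} (D : Grid n) (i j : Fin n) : Prop :=
  Dotted D i j ∧ HasDotBelow D i j ∧ HasDotRight D i j

/-- `p` is the nearest dotted cell above `l` in the column of `l`. -/
def ParentAbove {n : ℕ} (D : Grid n) (p l : Fin n × Fin n) : Prop :=
  p.2 = l.2 ∧ p.1 < l.1 ∧ Dotted D p.1 p.2 ∧
    ∀ k : Fin n, p.1 < k → k < l.1 → ¬Dotted D k l.2

/-- `p` is the nearest dotted cell to the left of `l` in the row of `l`,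
and there is no dotted cell above `l` in its column. -/
def ParentLeft {n : ℕ} (D : Grid n) (p l : Fin n × Fin n) : Prop :=
  p.1 = l.1 ∧ p.2 < l.2 ∧ Dotted D p.1 p.2 ∧
    (∀ k : Fin n, p.2 < k → k < l.2 → ¬Dotted D l.1 k) ∧
    ¬HasDotAbove D l.1 l.2

/-- `p` is the parent of the dot `l`: the nearest dotted cell above `l` in its
column if such a cell exists, otherwise the nearest dotted cell to its left. -/
def IsParent {n : ℕ} (D : Grid n) (p l : Fin n × Fin n) : Prop :=
  ParentAbove D p l ∨ ParentLeft D p l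

/-- `c` is the left child of the internal dot `p`: the nearest dot below `p`
in the column of `p`. -/
def IsLeftChild {n : ℕ} (D : Grid n) (p c : Fin n × Fin n) : Prop :=
  c.2 = p.2 ∧ p.1 < c.1 ∧ Dotted D c.1 c.2 ∧
    ∀ k : Fin n, p.1 < k → k < c.1 → ¬Dotted D k p.2

/-- `c` is the right child of the internal dot `p`: the nearest dot to the
right of `p` in the row of `p`. -/
def IsRightChild {n : ℕ} (D : Grid n) (p c : Fin n × Fin n) : Prop :=
  c.1 = p.1 ∧ p.2 < c.2 ∧ Dotted D c.1 c.2 ∧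
    ∀ k : Fin n, p.2 < k → k < c.2 → ¬Dotted D p.1 k

/-- A left leaf: a leaf whose parent is above it in its column. -/
def IsLeftLeaf {n : ℕ} (D : Grid n) (l : Fin n × Fin n) : Prop :=
  IsLeaf D l.1 l.2 ∧ ∃ p : Fin n × Fin n, ParentAbove D p l

/-- A right leaf: a leaf whose parent is to its left in its row. -/
def IsRightLeaf {n : ℕ} (D : Grid n) (l : Fin n × Fin n) : Prop :=
  IsLeaf D l.1 l.2 ∧ ∃ p : Fin n × Fin n, ParentLeft D p l

/-- A short leaf: a leaf whose parent lies in a cell adjacent to it. -/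
def IsShortLeaf {n : ℕ} (D : Grid n) (l : Fin n × Fin n) : Prop :=
  IsLeaf D l.1 l.2 ∧ ∃ p : Fin n × Fin n, IsParent D p l ∧
    (((p.1 : ℕ) + 1 = (l.1 : ℕ) ∧ p.2 = l.2) ∨ ((p.2 : ℕ) + 1 = (l.2 : ℕ) ∧ p.1 = l.1))

/-- A long leaf: a leaf which is not short. -/
def IsLongLeaf {n : ℕ} (D : Grid n) (l : Fin n × Fin n) : Prop :=
  IsLeaf D l.1 l.2 ∧ ¬IsShortLeaf D l

/-- All leaves of `D` are short (i.e. `D ∈ 𝒜ₙ`). -/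
def AllLeavesShort {n : ℕ} (D : Grid n) : Prop :=
  ∀ l : Fin n × Fin n, IsLeaf D l.1 l.2 → IsShortLeaf D l

/-- `π` is the permutation associated with the CNAT `D`: for every row `i`,
the leaf of row `i` lies in column `π i`. -/
def IsAssocPerm {n : ℕ} (D : Grid n) (π : Equiv.Perm (Fin n)) : Prop :=
  ∀ i : Fin n, IsLeaf D i (π i)

/-- Two left leaves `l₁`, `l₂` (with respective parents `p₁`, `p₂`) are
interacting if `r(p₁) < r(l₂) < r(l₁)` or `r(p₂) < r(l₁) < r(l₂)`. -/
def InteractingLeft {n : ℕ} (D : Grid n) (l₁ l₂ : Fin n × Fin n) : Prop :=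
  IsLeftLeaf D l₁ ∧ IsLeftLeaf D l₂ ∧
    ∃ p₁ p₂ : Fin n × Fin n, ParentAbove D p₁ l₁ ∧ ParentAbove D p₂ l₂ ∧
      ((p₁.1 < l₂.1 ∧ l₂.1 < l₁.1) ∨ (p₂.1 < l₁.1 ∧ l₁.1 < l₂.1))

/-- Two right leaves `l₁`, `l₂` (with respective parents `p₁`, `p₂`) are
interacting if `c(p₁) < c(l₂) < c(l₁)` or `c(p₂) < c(l₁) < c(l₂)`. -/
def InteractingRight {n : ℕ} (D : Grid n) (l₁ l₂ : Fin n × Fin n) : Prop :=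
  IsRightLeaf D l₁ ∧ IsRightLeaf D l₂ ∧
    ∃ p₁ p₂ : Fin n × Fin n, ParentLeft D p₁ l₁ ∧ ParentLeft D p₂ l₂ ∧
      ((p₁.2 < l₂.2 ∧ l₂.2 < l₁.2) ∨ (p₂.2 < l₁.2 ∧ l₁.2 < l₂.2))

/-- Two leaves are interacting (as left leaves or as right leaves). -/
def Interacting {n : ℕ} (D : Grid n) (l₁ l₂ : Fin n × Fin n) : Prop :=
  InteractingLeft D l₁ l₂ ∨ InteractingRight D l₁ l₂

/-- The switch `S(T, l₁, l₂)` of two interacting leaves: `l₁` and `l₂` are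
erased and replaced by dots at `(r(l₂), c(l₁))` and `(r(l₁), c(l₂))`
(for left leaves this exchanges their row labels, for right leaves this
exchanges their column labels; both descriptions yield the same filling). -/
def switchLeaves {n : ℕ} (D : Grid n) (l₁ l₂ : Fin n × Fin n) : Grid n := fun i j =>
  if (i = l₂.1 ∧ j = l₁.2) ∨ (i = l₁.1 ∧ j = l₂.2) then true
  else if (i = l₁.1 ∧ j = l₁.2) ∨ (i = l₂.1 ∧ j = l₂.2) then false
  else D i j


open Classical in
theorem even_of_allShort {n : ℕ} (D : Grid n) (hD : IsCNAT D) (hS : AllLeavesShort D) :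
    Even n := by
  obtain ⟨-, hxor, hrow, hcol, hcomp⟩ := hD
  have hr : ∀ i, ∃ j, IsLeaf D i j := by
    intro i
    obtain ⟨j0, hj0⟩ := hrow i
    obtain ⟨j, hj, hmax⟩ := Finset.exists_max_image (Finset.univ.filter fun j => Dotted D i j) id
      ⟨j0, by simpa using hj0⟩
    have hj : Dotted D i j := by simpa using hj
    have hnr : ¬ HasDotRight D i j := by
      rintro ⟨j', hlt, hd⟩
      exact absurd (hmax j' (by simpa using hd)) (not_le.mpr hlt)
    rcases hcomp i j hj with h | h
    · exact absurd h.2 hnr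
    · exact ⟨j, hj, h⟩
  have hc : ∀ j, ∃ i, IsLeaf D i j := by
    intro j
    obtain ⟨i0, hi0⟩ := hcol j
    obtain ⟨i, hi, hmax⟩ := Finset.exists_max_image (Finset.univ.filter fun i => Dotted D i j) id
      ⟨i0, by simpa using hi0⟩
    have hi : Dotted D i j := by simpa using hi
    have hnr : ¬ HasDotBelow D i j := by
      rintro ⟨i', hlt, hd⟩
      exact absurd (hmax i' (by simpa using hd)) (not_le.mpr hlt)
    rcases hcomp i j hi with h | h
    · exact absurd h.1 hnr
    · exact ⟨i, hi, h⟩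
  choose r hr using hr
  choose c hc using hc
  -- leaves are maximal in their rows and columns
  have rle : ∀ i j k, IsLeaf D i j → Dotted D i k → k ≤ j := fun i j k h hk =>
    not_lt.mp fun hlt => h.2.2 ⟨k, hlt, hk⟩
  have cle : ∀ i j k, IsLeaf D i j → Dotted D k j → k ≤ i := fun i j k h hk =>
    not_lt.mp fun hlt => h.2.1 ⟨k, hlt, hk⟩
  have runiq : ∀ i j, IsLeaf D i j → j = r i := fun i j h =>
    le_antisymm (rle _ _ _ (hr i) h.1) (rle _ _ _ h (hr i).1)
  have cuniq : ∀ i j, IsLeaf D i j → i = c j := fun i j h =>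
    le_antisymm (cle _ _ _ (hc j) h.1) (cle _ _ _ h (hc j).1)
  have hcr : ∀ i, c (r i) = i := fun i => (cuniq _ _ (hr i)).symm
  have hrc : ∀ j, r (c j) = j := fun j => (runiq _ _ (hc j)).symm
  have hup : ∀ i, HasDotAbove D i (r i) → ∃ i' : Fin n, (i' : ℕ) + 1 = i ∧ Dotted D i' (r i) := by
    intro i hi
    obtain ⟨-, ⟨p1, p2⟩, hp, hadj⟩ := hS (i, r i) (hr i)
    rcases hp with ⟨h1, h2, h3, -⟩ | ⟨-, -, -, -, h5⟩
    · simp only at h1 h2 h3 hadj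
      subst h1
      rcases hadj with h | h
      · exact ⟨p1, h.1, h3⟩
      · omega
    · exact absurd hi h5
  have hleft : ∀ i, ¬ HasDotAbove D i (r i) →
      ∃ j' : Fin n, (j' : ℕ) + 1 = r i ∧ Dotted D i j' := by
    intro i hi
    obtain ⟨-, ⟨p1, p2⟩, hp, hadj⟩ := hS (i, r i) (hr i)
    rcases hp with ⟨h1, h2, h3, -⟩ | ⟨h1, h2, h3, -, h5⟩
    · simp only at h1 h2 h3
      subst h1
      exact absurd ⟨p1, h2, h3⟩ hi
    · simp only at h1 h2 h3 hadj
      subst h1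
      rcases hadj with h | h
      · omega
      · exact ⟨p2, h.1, h3⟩
  choose! u hu1 hu2 using hup
  choose! v hv1 hv2 using hleft
  have hT : (Finset.univ.filter fun i => HasDotAbove D i (r i)).card ≤
      (Finset.univ.filter fun i => ¬ HasDotAbove D i (r i)).card := by
    refine Finset.card_le_card_of_injOn u ?_ ?_
    · intro i hi
      have hi : HasDotAbove D i (r i) := by simpa using hi
      have h1 := hu1 i hi
      have h2 := hu2 i hi
      have hne : r i ≠ r (u i) := by
        intro h
        have := congrArg c h
        rw [hcr, hcr] at this
        have := congrArg Fin.val this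
        omega
      have hlt := lt_of_le_of_ne (rle _ _ _ (hr (u i)) h2) hne
      have hx := hxor _ _ (hr (u i)).1 (fun h => by have := Fin.lt_def.mp hlt; omega)
      have hL : HasDotLeft D (u i) (r (u i)) := ⟨_, hlt, h2⟩
      simp only [Finset.coe_filter, Finset.mem_univ, true_and, Set.mem_setOf_eq]
      rcases hx with h | h
      · exact absurd hL h.2
      · exact h.2
    · intro i hi k hk h
      have h1 := hu1 i (by simpa using hi)
      have h2 := hu1 k (by simpa using hk)
      rw [h] at h1
      exact Fin.ext (by omega)
  have hU : (Finset.univ.filter fun i => ¬ HasDotAbove D i (r i)).card ≤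
      (Finset.univ.filter fun i => HasDotAbove D i (r i)).card := by
    refine Finset.card_le_card_of_injOn (fun i => c (v i)) ?_ ?_
    · intro i hi
      have hi : ¬ HasDotAbove D i (r i) := by simpa using hi
      have h1 := hv1 i hi
      have h2 := hv2 i hi
      have hne : i ≠ c (v i) := by
        intro h
        have := congrArg r h
        rw [hrc] at this
        have := congrArg Fin.val this
        omega
      have hlt := lt_of_le_of_ne (cle _ _ _ (hc (v i)) h2) hne
      simp only [Finset.coe_filter, Finset.mem_univ, true_and, Set.mem_setOf_eq, hrc]
      exact ⟨_, hlt, h2⟩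
    · intro i hi k hk h
      have h1 := hv1 i (by simpa using hi)
      have h2 := hv1 k (by simpa using hk)
      have h3 : v i = v k := by
        have := congrArg r h
        simpa [hrc] using this
      rw [h3] at h1
      have h4 : r i = r k := Fin.ext (by omega)
      have := congrArg c h4
      rwa [hcr, hcr] at this
  have hsum := Finset.card_filter_add_card_filter_not (s := (Finset.univ : Finset (Fin n)))
    (fun i => HasDotAbove D i (r i))
  rw [Finset.card_univ, Fintype.card_fin] at hsum
  exact ⟨_, by rw [← hsum]; congr 1; exact le_antisymm hU hT⟩

/-- For every odd `n ≥ 3`, there is no CNAT of size `n` all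
of whose leaves are short: the set `𝒜ₙ` is empty. -/
theorem cnat_all_short_odd_empty (n : ℕ) (hn : 3 ≤ n) (hodd : Odd n) :
    ¬∃ D : Grid n, IsCNAT D ∧ AllLeavesShort D := by
  rintro ⟨D, hD, hS⟩
  exact (Nat.not_even_iff_odd.mpr hodd) (even_of_allShort D hD hS)

end CNATf
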